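/- arXiv:2104.08822 — 2 statements merged into one kernel-verified Lean document; each statement's English description precedes it below -/
import Mathlib

section
/- Let K = [1,2] and h : (0, +∞) → ℝ, h(x) = 5x + ln(1 + 10x). Then for every z ∈ [1,2], the set argmin_{x ∈ [1,2]} [h(x) + (1/2)(x − z)²] equals {1}, and for every α with 0 < α < 5 one has h(1) − h(x) ≤ α(1 − z)(x − 1) for all x, z ∈ [1,2], i.e. h is prox-convex on [1,2] with prox-convex value α. -/
open Set

/-- `x ↦ log (1 + 10 x)` attains its minimum over `[1, ∞)` at `1`. -/
lemma log_one_add_ten_le {x : ℝ} (hx : 1 ≤ x) :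
    Real.log (1 + 10 * 1) ≤ Real.log (1 + 10 * x) :=
  Real.log_le_log (by norm_num) (by linarith)

/-- Quadratic growth at `1` of the proximal objective of `h(x) = 5 x + log (1 + 10 x)`. -/
lemma prox_objective_growth {x z : ℝ} (hx : 1 ≤ x) (hz : z ≤ 2) :
    (5 * 1 + Real.log (1 + 10 * 1)) + (1/2) * (1 - z) ^ 2 + 4 * (x - 1) ≤
      (5 * x + Real.log (1 + 10 * x)) + (1/2) * (x - z) ^ 2 := by
  have hlog := log_one_add_ten_le hx
  have hquad : 5 * 1 + (1/2) * (1 - z) ^ 2 + 4 * (x - 1) ≤ 5 * x + (1/2) * (x - z) ^ 2 := by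
    nlinarith [mul_nonneg (sub_nonneg.2 hx) (sub_nonneg.2 hz), sq_nonneg (x - 1)]
  calc _ = (5 * 1 + (1/2) * (1 - z) ^ 2 + 4 * (x - 1)) + Real.log (1 + 10 * 1) := by ring
    _ ≤ (5 * x + (1/2) * (x - z) ^ 2) + Real.log (1 + 10 * x) := add_le_add hquad hlog
    _ = _ := by ring

/-- For `h(x) = 5x + ln(1 + 10x)` on `K = [1,2]`: for every `z ∈ [1,2]`
the set `argmin_{x ∈ [1,2]} [h(x) + (1/2)(x − z)²]` equals `{1}`, and for every
`0 < α < 5` one has `h(1) − h(x) ≤ α(1 − z)(x − 1)` for all `x, z ∈ [1,2]`,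
i.e. `h` is prox-convex on `[1,2]` with prox-convex value `α`. -/
theorem statement_7 :
    (∀ z ∈ Icc (1:ℝ) 2,
      {x ∈ Icc (1:ℝ) 2 | ∀ y ∈ Icc (1:ℝ) 2,
        (5 * x + Real.log (1 + 10 * x)) + (1/2) * (x - z) ^ 2 ≤
          (5 * y + Real.log (1 + 10 * y)) + (1/2) * (y - z) ^ 2} = {1}) ∧
    (∀ α : ℝ, 0 < α → α < 5 → ∀ z ∈ Icc (1:ℝ) 2, ∀ x ∈ Icc (1:ℝ) 2,
      (5 * 1 + Real.log (1 + 10 * 1)) - (5 * x + Real.log (1 + 10 * x)) ≤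
        α * ((1 - z) * (x - 1))) := by
  refine ⟨fun z hz => ?_, fun α hα hα5 z hz x hx => ?_⟩
  · obtain ⟨hz1, hz2⟩ := hz
    ext x
    simp only [mem_ofPred_eq, mem_singleton_iff]
    constructor
    · rintro ⟨⟨hx1, hx2⟩, hmin⟩
      have hle := hmin 1 ⟨le_rfl, by norm_num⟩
      have hgrowth := prox_objective_growth hx1 hz2
      linarith
    · rintro rfl
      refine ⟨⟨le_rfl, by norm_num⟩, fun y hy => ?_⟩
      have hgrowth := prox_objective_growth hy.1 hz2
      linarith [hy.1]
  · obtain ⟨hz1, hz2⟩ := hz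
    have hlog := log_one_add_ten_le hx.1
    have hαz : α * (z - 1) ≤ 5 := by nlinarith
    nlinarith [mul_nonneg (sub_nonneg.2 hx.1) (sub_nonneg.2 hαz)]
end

section
/- Let h : ℝⁿ → ℝ be lower semicontinuous and strongly quasiconvex with modulus β = 1, let z ∈ ℝⁿ and x̄ ∈ prox_h(z), and write S := {y ∈ ℝⁿ : h(y) ≤ h(x̄)}. If there exists ξ ∈ ∂^≤ h(x̄) such that [h(x̄) + (1/2)‖x̄ − z‖²] − [h(y) + (1/2)‖y − z‖²] ≤ ⟨ξ, y − x̄⟩ for all y ∈ S, then h(x̄) − h(y) ≤ ⟨x̄ − z, y − x̄⟩ for all y ∈ S, i.e. h is prox-convex on S with prox-convex value 1. -/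
open Set RealInnerProductSpace

/-- If the quadratic `l ↦ l * (a + l * D - D / 2)` is nonnegative on `[0, 1]` and `0 ≤ D`,
then its slope `a - D / 2` at the origin is nonnegative. -/
theorem half_le_of_forall_segment {a D : ℝ} (hD : 0 ≤ D)
    (H : ∀ l ∈ Icc (0:ℝ) 1, 0 ≤ l * (a + l * D - D / 2)) : D / 2 ≤ a := by
  by_contra! hlt
  have h1 := H 1 ⟨zero_le_one, le_rfl⟩
  have hDpos : 0 < D := by
    rcases hD.eq_or_lt with h0 | h0
    · subst h0; linarith
    · exact h0
  have hl : 0 < (D / 2 - a) / (2 * D) := div_pos (by linarith) (by linarith)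
  have h2 := H _ ⟨hl.le, (div_le_one (by linarith)).2 (by linarith)⟩
  have h3 : (D / 2 - a) / (2 * D) * D = (D / 2 - a) / 2 := by field_simp
  have h4 := nonneg_of_mul_nonneg_right h2 hl
  linarith

/-- Let `h : ℝⁿ → ℝ` be lower semicontinuous and strongly quasiconvex
with modulus `β = 1`, `z ∈ ℝⁿ`, `x̄ ∈ prox_h(z)`, and `S = {y : h(y) ≤ h(x̄)}`. If there
is `ξ ∈ ∂^≤ h(x̄)` with `h_z(x̄) − h_z(y) ≤ ⟨ξ, y − x̄⟩` for all `y ∈ S`, then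
`h(x̄) − h(y) ≤ ⟨x̄ − z, y − x̄⟩` for all `y ∈ S`, i.e. `h` is prox-convex on `S` with
prox-convex value `1`. -/
theorem statement_14 {n : ℕ} (h : EuclideanSpace ℝ (Fin n) → ℝ)
    (hlsc : LowerSemicontinuous h)
    (hsqc : ∀ x y : EuclideanSpace ℝ (Fin n), ∀ l ∈ Icc (0:ℝ) 1,
      h (l • y + (1 - l) • x) ≤ max (h x) (h y) - l * (1 - l) * ((1:ℝ)/2) * ‖x - y‖ ^ 2)
    (z xbar : EuclideanSpace ℝ (Fin n))
    (hprox : ∀ y, h xbar + (1/2) * ‖xbar - z‖ ^ 2 ≤ h y + (1/2) * ‖y - z‖ ^ 2)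
    (ξ : EuclideanSpace ℝ (Fin n))
    (hξ : ∀ y, h y ≤ h xbar → h xbar + ⟪ξ, y - xbar⟫ ≤ h y)
    (hcond : ∀ y, h y ≤ h xbar →
      (h xbar + (1/2) * ‖xbar - z‖ ^ 2) - (h y + (1/2) * ‖y - z‖ ^ 2) ≤ ⟪ξ, y - xbar⟫) :
    ∀ y, h y ≤ h xbar → h xbar - h y ≤ ⟪xbar - z, y - xbar⟫ := by
  intro y hy
  have expand : ∀ l : ℝ, ‖l • y + (1 - l) • xbar - z‖ ^ 2
      = ‖xbar - z‖ ^ 2 + 2 * l * ⟪xbar - z, y - xbar⟫ + l ^ 2 * ‖y - xbar‖ ^ 2 := by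
    intro l
    have e : l • y + (1 - l) • xbar - z = (xbar - z) + l • (y - xbar) := by module
    rw [e, norm_add_sq_real, real_inner_smul_right, norm_smul, mul_pow, Real.norm_eq_abs, sq_abs]
    ring
  have segment : ∀ l ∈ Icc (0:ℝ) 1,
      0 ≤ l * (⟪xbar - z, y - xbar⟫ + l * ‖y - xbar‖ ^ 2 - ‖y - xbar‖ ^ 2 / 2) := by
    intro l hl
    have h1 := hsqc xbar y l hl
    have h2 := hprox (l • y + (1 - l) • xbar)
    rw [max_eq_left hy, norm_sub_rev] at h1
    rw [expand l] at h2
    linarith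
  have monotone_bound := half_le_of_forall_segment (sq_nonneg ‖y - xbar‖) segment
  have h1 := hξ y hy
  have h2 := hcond y hy
  have h3 := expand 1
  simp only [one_smul, sub_self, zero_smul, add_zero] at h3
  linarith
end
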